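/- τ_min^sh is the coarsest Hausdorff shift-continuous topology on C_Z^0: for every Hausdorff shift-continuous topology τ on C_Z^0 one has τ_min^sh ⊆ τ. Consequently (C_Z^0, τ_min^sh) is a minimal semitopological semigroup: no Hausdorff shift-continuous topology on C_Z^0 is strictly coarser than τ_min^sh. -/

import Mathlib

/-- The underlying set of the extended bicyclic semigroup: `ℤ × ℤ`. -/
abbrev CZ : Type := ℤ × ℤ

/-- Multiplication of the extended bicyclic semigroup `C_Z`. -/
def CZmul (p q : CZ) : CZ :=
  if p.2 < q.1 then (p.1 - p.2 + q.1, q.2)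
  else if p.2 = q.1 then (p.1, q.2)
  else (p.1, q.2 + p.2 - q.1)

/-- `C_Z` with an adjoined zero; `none` is the zero element. -/
abbrev CZ0 : Type := Option CZ

/-- Multiplication of `C_Z^0`; `none` is a zero element. -/
def CZ0mul : CZ0 → CZ0 → CZ0
  | some p, some q => some (CZmul p q)
  | _, _ => none

/-- Natural partial order on `C_Z`: `(a,b) ≼ (x,y)` iff `a - b = x - y` and `x ≤ a`. -/
def CZle (p q : CZ) : Prop := p.1 - p.2 = q.1 - q.2 ∧ q.1 ≤ p.1

/-- The upper set `↑≼(a,b)` in `C_Z`. -/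
def upSet (p : CZ) : Set CZ := {q | CZle p q}

/-- Natural partial order on `C_Z^0`: zero is below everything. -/
def CZ0le : CZ0 → CZ0 → Prop
  | none, _ => True
  | some _, none => False
  | some p, some q => CZle p q

/-- A topology on `C_Z^0` is shift-continuous if all left and right shifts are continuous. -/
def ShiftCont (t : TopologicalSpace CZ0) : Prop :=
  ∀ s : CZ0, @Continuous _ _ t t (fun u => CZ0mul s u) ∧ @Continuous _ _ t t (fun u => CZ0mul u s)

/-- The basic neighbourhood `U^↑_{(a₁,b₁),…,(a_k,b_k)}` of zero: the complement in `C_Z^0`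
of `↑≼(a₁,b₁) ∪ ⋯ ∪ ↑≼(a_k,b_k)`. -/
def UpF (F : Finset CZ) : Set CZ0 :=
  (Option.some '' ⋃ ab ∈ F, upSet ab)ᶜ

/-- The topology `τ_min^sh` on `C_Z^0`: all nonzero elements are isolated, and the sets
`U^↑_{(a₁,b₁),…,(a_k,b_k)}` form a neighbourhood base at zero. -/
def tauMinSh : TopologicalSpace CZ0 :=
  TopologicalSpace.generateFrom
    ({U | ∃ p : CZ, U = {some p}} ∪ {U | ∃ F : Finset CZ, U = UpF F})

/-- `↑≼(a,b)` is the set of solutions `u` of `(a,a) · u = (a,b)`. -/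
lemma CZ0mul_left_eq_iff_mem_upSet (a b : ℤ) (u : CZ0) :
    CZ0mul (some (a, a)) u = some (a, b) ↔ u ∈ some '' upSet (a, b) := by
  rcases u with _ | ⟨x, y⟩
  · simp [CZ0mul]
  · simp only [CZ0mul, CZmul, upSet, CZle, Set.mem_image, Set.mem_ofPred_eq, Option.some.injEq,
      exists_eq_right]
    grind

lemma CZ0mul_left_ne_self_iff (a : ℤ) (u : CZ0) :
    CZ0mul (some (a, a)) u ≠ u ↔ ∃ x y : ℤ, u = some (x, y) ∧ x < a := by
  rcases u with _ | ⟨x, y⟩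
  · simp [CZ0mul]
  · simp only [CZ0mul, CZmul, ne_eq, Option.some.injEq, Prod.mk.injEq, exists_and_right]
    constructor
    · intro h
      refine ⟨x, ⟨y, rfl, rfl⟩, ?_⟩
      grind
    · rintro ⟨x', ⟨y', rfl, rfl⟩, h⟩
      grind

lemma CZ0mul_right_ne_self_iff (b : ℤ) (u : CZ0) :
    CZ0mul u (some (b, b)) ≠ u ↔ ∃ x y : ℤ, u = some (x, y) ∧ y < b := by
  rcases u with _ | ⟨x, y⟩
  · simp [CZ0mul]
  · simp only [CZ0mul, CZmul, ne_eq, Option.some.injEq, Prod.mk.injEq]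
    constructor
    · intro h
      refine ⟨x, y, ⟨rfl, rfl⟩, ?_⟩
      grind
    · rintro ⟨x', y', ⟨rfl, rfl⟩, h⟩
      grind

/-- The set `{(x,y) : x ≤ a, y ≤ b}` of nonzero elements of `C_Z^0`. -/
def lowerQuadrant (a b : ℤ) : Set CZ0 := {u | ∃ x y : ℤ, u = some (x, y) ∧ x ≤ a ∧ y ≤ b}

lemma isOpen_lowerQuadrant [t : TopologicalSpace CZ0] [T2Space CZ0] (ht : ShiftCont t)
    (a b : ℤ) : IsOpen (lowerQuadrant a b) := by
  have h : lowerQuadrant a b = {u | CZ0mul (some (a + 1, a + 1)) u ≠ u} ∩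
      {u | CZ0mul u (some (b + 1, b + 1)) ≠ u} := by
    ext u
    simp only [lowerQuadrant, Set.mem_inter_iff, Set.mem_ofPred_eq, CZ0mul_left_ne_self_iff,
      CZ0mul_right_ne_self_iff, Int.lt_add_one_iff]
    constructor
    · rintro ⟨x, y, rfl, hx, hy⟩
      exact ⟨⟨x, y, rfl, hx⟩, ⟨x, y, rfl, hy⟩⟩
    · rintro ⟨⟨x, y, rfl, hx⟩, ⟨x', y', he, hy⟩⟩
      cases he
      exact ⟨x, y, rfl, hx, hy⟩
  rw [h]
  exact (isOpen_ne_fun (ht _).1 continuous_id).inter (isOpen_ne_fun (ht _).2 continuous_id)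

/-- The two-sided shift by `(a-1,a-1)` and `(b-1,b-1)` maps the quadrant below `(a,b)` to elements
with coordinates at least `(a-1,b-1)`, and only `(a,b)` is sent to `(a,b)`. -/
lemma eq_of_mem_lowerQuadrant_of_shift {a b : ℤ} {u : CZ0} (hu : u ∈ lowerQuadrant a b)
    (hm : CZ0mul (CZ0mul (some (a - 1, a - 1)) u) (some (b - 1, b - 1)) ∈ lowerQuadrant a b)
    (hn : CZ0mul (CZ0mul (some (a - 1, a - 1)) u) (some (b - 1, b - 1)) ∉
      ({some (a - 1, b - 1), some (a - 1, b), some (a, b - 1)} : Set CZ0)) :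
    u = some (a, b) := by
  obtain ⟨x, y, rfl, hx, hy⟩ := hu
  obtain ⟨x', y', he, hx', hy'⟩ := hm
  rw [he] at hn
  simp only [CZ0mul, CZmul, Option.some.injEq] at he
  simp only [Set.mem_insert_iff, Set.mem_singleton_iff, Option.some.injEq, Prod.mk.injEq] at hn ⊢
  split_ifs at he <;> simp only [Prod.mk.injEq] at he <;> omega

lemma isOpen_singleton_some [t : TopologicalSpace CZ0] [T2Space CZ0] (ht : ShiftCont t)
    (p : CZ) : IsOpen ({some p} : Set CZ0) := by
  obtain ⟨a, b⟩ := p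
  let f : CZ0 → CZ0 := fun u => CZ0mul (CZ0mul (some (a - 1, a - 1)) u) (some (b - 1, b - 1))
  have hf : Continuous f := (ht (some (b - 1, b - 1))).2.comp (ht (some (a - 1, a - 1))).1
  let T : Set CZ0 := {some (a - 1, b - 1), some (a - 1, b), some (a, b - 1)}
  have hT : IsClosed T := (Set.toFinite T).isClosed
  have hQ := isOpen_lowerQuadrant ht a b
  have h : ({some (a, b)} : Set CZ0) = lowerQuadrant a b ∩ f ⁻¹' (lowerQuadrant a b \ T) := by
    ext u
    constructor
    · rintro rfl
      have hfab : f (some (a, b)) = some (a, b) := by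
        simp only [f, CZ0mul, CZmul]
        grind
      have hab : (some (a, b) : CZ0) ∈ lowerQuadrant a b := ⟨a, b, rfl, le_rfl, le_rfl⟩
      refine ⟨hab, ?_⟩
      rw [Set.mem_preimage, hfab]
      refine ⟨hab, ?_⟩
      grind
    · rintro ⟨hu, hm, hn⟩
      exact eq_of_mem_lowerQuadrant_of_shift hu hm hn
  rw [h]
  exact hQ.inter ((hQ.sdiff hT).preimage hf)

lemma isClosed_image_upSet [t : TopologicalSpace CZ0] [T2Space CZ0] (ht : ShiftCont t)
    (p : CZ) : IsClosed (some '' upSet p : Set CZ0) := by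
  have h : (some '' upSet p : Set CZ0) = CZ0mul (some (p.1, p.1)) ⁻¹' {some p} :=
    Set.ext fun u => (CZ0mul_left_eq_iff_mem_upSet p.1 p.2 u).symm
  rw [h]
  exact isClosed_singleton.preimage (ht _).1

lemma isOpen_UpF [t : TopologicalSpace CZ0] [T2Space CZ0] (ht : ShiftCont t)
    (F : Finset CZ) : IsOpen (UpF F) := by
  rw [UpF, Set.image_iUnion₂, isOpen_compl_iff]
  exact F.finite_toSet.isClosed_biUnion fun p _ => isClosed_image_upSet ht p

/-- `tauMinSh` is coarser than every Hausdorff shift-continuous topology. -/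
lemma le_tauMinSh (t : TopologicalSpace CZ0) [T2Space CZ0] (ht : ShiftCont t) :
    t ≤ tauMinSh := by
  refine le_generateFrom ?_
  rintro _ (⟨p, rfl⟩ | ⟨F, rfl⟩)
  · exact isOpen_singleton_some ht p
  · exact isOpen_UpF ht F

theorem stmt18 :
    (∀ t : TopologicalSpace CZ0, @T2Space CZ0 t → ShiftCont t → t ≤ tauMinSh) ∧
    (∀ t : TopologicalSpace CZ0, @T2Space CZ0 t → ShiftCont t → tauMinSh ≤ t →
      t = tauMinSh) := by
  exact ⟨fun t _ ht => le_tauMinSh t ht, fun t _ ht h => le_antisymm (le_tauMinSh t ht) h⟩
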